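/- arXiv:2409.17187 — 6 statements merged into one kernel-verified Lean document; each statement's English description precedes it below -/
import Mathlib

section
/- Let α > 0. For every x ∈ ℝ, ∫_ℝ K₁(x − y) K₁(y) dy = K₂(x); that is, the convolution of the Helmholtz kernel with itself equals the bi-Helmholtz kernel: (K₁ * K₁)(x) = (1/(4α²)) (α + |x|) e^{−|x|/α}. -/
open MeasureTheory Real

theorem integral_exp_neg_abs_sub_mul_exp_neg_abs {α : ℝ} (hα : 0 < α) {x : ℝ} (hx : 0 ≤ x) :
    ∫ y : ℝ, exp (-|x - y| / α) * exp (-|y| / α) = (α + x) * exp (-x / α) := by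
  set f : ℝ → ℝ := fun y => exp (-|x - y| / α) * exp (-|y| / α)
  have h_pos : 0 < 2 / α := by positivity
  have h_neg : -(2 / α) < 0 := by linarith
  have h_left : Set.EqOn (fun y => exp (-x / α) * exp (2 / α * y)) f (Set.Iic 0) := by
    intro y (hy : y ≤ 0)
    simp only [f]
    rw [abs_of_nonneg (by linarith : 0 ≤ x - y), abs_of_nonpos hy, ← exp_add, ← exp_add]
    congr 1
    ring
  have h_mid : Set.EqOn (fun _ => exp (-x / α)) f (Set.Ioc 0 x) := by
    rintro y ⟨hy, hyx⟩
    simp only [f]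
    rw [abs_of_nonneg (by linarith : 0 ≤ x - y), abs_of_pos hy, ← exp_add]
    congr 1
    ring
  have h_right : Set.EqOn (fun y => exp (x / α) * exp (-(2 / α) * y)) f (Set.Ioi x) := by
    intro y (hy : x < y)
    simp only [f]
    rw [abs_of_neg (by linarith : x - y < 0), abs_of_nonneg (hx.trans hy.le), ← exp_add, ← exp_add]
    congr 1
    ring
  have hi_left : IntegrableOn f (Set.Iic 0) :=
    IntegrableOn.congr_fun ((integrableOn_exp_mul_Iic h_pos 0).const_mul _) h_left
      measurableSet_Iic
  have hi_mid : IntegrableOn f (Set.Ioc 0 x) :=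
    IntegrableOn.congr_fun (integrableOn_const (by simp)) h_mid measurableSet_Ioc
  have hi_right : IntegrableOn f (Set.Ioi x) :=
    IntegrableOn.congr_fun ((integrableOn_exp_mul_Ioi h_neg x).const_mul _) h_right
      measurableSet_Ioi
  have hi_Ioi : IntegrableOn f (Set.Ioi 0) := by
    rw [← Set.Ioc_union_Ioi_eq_Ioi hx]
    exact hi_mid.union hi_right
  rw [← intervalIntegral.integral_Iic_add_Ioi hi_left hi_Ioi, ← Set.Ioc_union_Ioi_eq_Ioi hx,
    setIntegral_union (Set.Ioc_disjoint_Ioi le_rfl) measurableSet_Ioi hi_mid hi_right,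
    ← setIntegral_congr_fun measurableSet_Iic h_left,
    ← setIntegral_congr_fun measurableSet_Ioc h_mid,
    ← setIntegral_congr_fun measurableSet_Ioi h_right,
    integral_const_mul, integral_const_mul, integral_exp_mul_Iic h_pos,
    integral_exp_mul_Ioi h_neg, setIntegral_const]
  have h_exp : exp (-x / α) = exp (x / α) * exp (-(2 / α) * x) := by
    rw [← exp_add]
    congr 1
    ring
  simp only [mul_zero, exp_zero, smul_eq_mul, volume_real_Ioc_of_le hx, sub_zero, h_exp]
  field_simp
  ring

theorem stmt5 (α : ℝ) (hα : 0 < α)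
    (K₁ K₂ : ℝ → ℝ)
    (hK₁ : ∀ x, K₁ x = (1 / (2 * α)) * Real.exp (-|x| / α))
    (hK₂ : ∀ x, K₂ x = (1 / (4 * α ^ 2)) * (α + |x|) * Real.exp (-|x| / α)) :
    ∀ x : ℝ, (∫ y : ℝ, K₁ (x - y) * K₁ y) = K₂ x := by
  have h_abs (x : ℝ) : ∫ y : ℝ, exp (-|x - y| / α) * exp (-|y| / α)
      = (α + |x|) * exp (-|x| / α) := by
    rcases le_total 0 x with hx | hx
    · rw [abs_of_nonneg hx, integral_exp_neg_abs_sub_mul_exp_neg_abs hα hx]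
    · rw [abs_of_nonpos hx, ← integral_exp_neg_abs_sub_mul_exp_neg_abs hα (neg_nonneg.2 hx),
        ← integral_neg_eq_self]
      refine integral_congr_ae (.of_forall fun y => ?_)
      simp only [abs_neg]
      rw [← abs_neg (x - -y), neg_sub', sub_neg_eq_add, sub_eq_add_neg]
  intro x
  calc ∫ y : ℝ, K₁ (x - y) * K₁ y
      = ∫ y : ℝ, 1 / (4 * α ^ 2) * (exp (-|x - y| / α) * exp (-|y| / α)) := by
        refine integral_congr_ae (.of_forall fun y => ?_)
        simp only [hK₁]
        ring
    _ = K₂ x := by rw [integral_const_mul, h_abs, hK₂, mul_assoc]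
end

section
/- Let α > 0. For every x ≠ 0, the bi-Helmholtz kernel K₂ is four times differentiable at x and satisfies K₂(x) − 2α² K₂''(x) + α⁴ K₂''''(x) = 0. -/
theorem hasDerivAt_affine_mul_exp (a b c x : ℝ) :
    HasDerivAt (fun y => (a + b * y) * Real.exp (c * y))
      ((b + a * c + b * c * x) * Real.exp (c * x)) x := by
  have h₁ : HasDerivAt (fun y => a + b * y) b x := by
    simpa using ((hasDerivAt_id x).const_mul b).const_add a
  have h₂ : HasDerivAt (fun y => Real.exp (c * y)) (Real.exp (c * x) * c) x := by
    simpa using ((hasDerivAt_id x).const_mul c).exp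
  exact (h₁.mul h₂).congr_deriv (by ring)

theorem differentiableAt_and_deriv_of_eventuallyEq_affine_mul_exp {f : ℝ → ℝ} {a b c x : ℝ}
    (h : f =ᶠ[nhds x] fun y => (a + b * y) * Real.exp (c * y)) :
    DifferentiableAt ℝ f x ∧
      deriv f =ᶠ[nhds x] fun y => (b + a * c + b * c * y) * Real.exp (c * y) :=
  ⟨((hasDerivAt_affine_mul_exp a b c x).congr_of_eventuallyEq h).differentiableAt,
    h.deriv.trans (.of_forall fun y => (hasDerivAt_affine_mul_exp a b c y).deriv)⟩

theorem exists_eventually_abs_eq_mul {x : ℝ} (hx : x ≠ 0) :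
    ∃ s : ℝ, s ^ 2 = 1 ∧ ∀ᶠ y in nhds x, |y| = s * y := by
  rcases hx.lt_or_gt with hx | hx
  · refine ⟨-1, by norm_num, ?_⟩
    filter_upwards [Iio_mem_nhds hx] with y hy
    rw [abs_of_neg hy, neg_one_mul]
  · refine ⟨1, by norm_num, ?_⟩
    filter_upwards [Ioi_mem_nhds hx] with y hy
    rw [abs_of_pos hy, one_mul]

theorem stmt7 (α : ℝ) (hα : 0 < α)
    (K₂ : ℝ → ℝ)
    (hK₂ : ∀ x, K₂ x = (1 / (4 * α ^ 2)) * (α + |x|) * Real.exp (-|x| / α)) :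
    ∀ x : ℝ, x ≠ 0 →
      DifferentiableAt ℝ K₂ x ∧ DifferentiableAt ℝ (deriv K₂) x ∧
        DifferentiableAt ℝ (deriv^[2] K₂) x ∧ DifferentiableAt ℝ (deriv^[3] K₂) x ∧
        K₂ x - 2 * α ^ 2 * deriv^[2] K₂ x + α ^ 4 * deriv^[4] K₂ x = 0 := by
  intro x hx
  obtain ⟨s, hs, habs⟩ := exists_eventually_abs_eq_mul hx
  obtain ⟨a, b, c, hc, h₀⟩ : ∃ a b c : ℝ, α ^ 2 * c ^ 2 = 1 ∧
      K₂ =ᶠ[nhds x] fun y => (a + b * y) * Real.exp (c * y) := by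
    refine ⟨1 / (4 * α ^ 2) * α, 1 / (4 * α ^ 2) * s, -s / α, ?_, ?_⟩
    · field_simp
      exact hs
    · filter_upwards [habs] with y hy
      rw [hK₂, hy, show -(s * y) / α = -s / α * y by ring]
      ring
  obtain ⟨d₀, h₁⟩ := differentiableAt_and_deriv_of_eventuallyEq_affine_mul_exp h₀
  obtain ⟨d₁, h₂⟩ := differentiableAt_and_deriv_of_eventuallyEq_affine_mul_exp h₁
  obtain ⟨d₂, h₃⟩ := differentiableAt_and_deriv_of_eventuallyEq_affine_mul_exp h₂
  obtain ⟨d₃, h₄⟩ := differentiableAt_and_deriv_of_eventuallyEq_affine_mul_exp h₃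
  refine ⟨d₀, d₁, d₂, d₃, ?_⟩
  change K₂ x - 2 * α ^ 2 * deriv (deriv K₂) x + α ^ 4 * deriv (deriv (deriv (deriv K₂))) x = 0
  rw [h₀.eq_of_nhds, h₂.eq_of_nhds, h₄.eq_of_nhds]
  linear_combination (Real.exp (c * x) *
    ((a + b * x) * (α ^ 2 * c ^ 2 - 1) + 4 * b * c * α ^ 2)) * hc
end

section
/- Let α > 0 and let h : ℝ → ℝ be a Schwartz function. Define ū(x) = ∫_ℝ K₁(x − y) h(y) dy. Then ū is twice differentiable on ℝ and satisfies ū(x) − α² ū''(x) = h(x) for every x ∈ ℝ. -/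
open MeasureTheory SchwartzMap

theorem hasDerivAt_integral_Iic {f : ℝ → ℝ} (hf : Continuous f)
    (hint : ∀ x, IntegrableOn f (Set.Iic x)) (x : ℝ) :
    HasDerivAt (fun x => ∫ y in Set.Iic x, f y) (f x) x := by
  have h_eq : (fun x => ∫ y in Set.Iic x, f y) =
      fun x => (∫ y in Set.Iic 0, f y) + ∫ y in (0 : ℝ)..x, f y := by
    funext z
    rw [← intervalIntegral.integral_Iic_sub_Iic (hint 0) (hint z)]
    ring
  rw [h_eq]
  exact (hf.integral_hasStrictDerivAt 0 x).hasDerivAt.const_add _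

theorem hasDerivAt_integral_Ioi {f : ℝ → ℝ} (hf : Continuous f)
    (hint : ∀ x, IntegrableOn f (Set.Ioi x)) (x : ℝ) :
    HasDerivAt (fun x => ∫ y in Set.Ioi x, f y) (-f x) x := by
  have h_eq : (fun x => ∫ y in Set.Ioi x, f y) =
      fun x => (∫ y in Set.Ioi 0, f y) - ∫ y in (0 : ℝ)..x, f y := by
    funext z
    rw [← intervalIntegral.integral_Ioi_sub_Ioi' (hint 0) (hint z)]
    ring
  rw [h_eq]
  exact (hf.integral_hasStrictDerivAt 0 x).hasDerivAt.const_sub _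

theorem integrableOn_Iic_exp_div_mul {α : ℝ} (hα : 0 < α) {h : ℝ → ℝ} (hi : Integrable h)
    (x : ℝ) : IntegrableOn (fun y => Real.exp (y / α) * h y) (Set.Iic x) := by
  refine Integrable.bdd_mul (c := Real.exp (x / α)) hi.integrableOn
    (by fun_prop) ?_
  filter_upwards [ae_restrict_mem measurableSet_Iic] with y hy
  rw [Real.norm_eq_abs, Real.abs_exp]
  gcongr
  exact hy

theorem integrableOn_Ioi_exp_neg_div_mul {α : ℝ} (hα : 0 < α) {h : ℝ → ℝ} (hi : Integrable h)
    (x : ℝ) : IntegrableOn (fun y => Real.exp (-y / α) * h y) (Set.Ioi x) := by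
  refine Integrable.bdd_mul (c := Real.exp (-x / α)) hi.integrableOn
    (by fun_prop) ?_
  filter_upwards [ae_restrict_mem measurableSet_Ioi] with y hy
  rw [Real.norm_eq_abs, Real.abs_exp]
  gcongr
  exact le_of_lt hy

theorem integral_exp_neg_abs_sub_div_mul {α : ℝ} (hα : 0 < α) {h : ℝ → ℝ} (hi : Integrable h)
    (x : ℝ) : ∫ y, Real.exp (-|x - y| / α) * h y =
      Real.exp (-x / α) * (∫ y in Set.Iic x, Real.exp (y / α) * h y) +
      Real.exp (x / α) * ∫ y in Set.Ioi x, Real.exp (-y / α) * h y := by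
  have hleft : Set.EqOn (fun y => Real.exp (-|x - y| / α) * h y)
      (fun y => Real.exp (-x / α) * (Real.exp (y / α) * h y)) (Set.Iic x) := by
    intro y hy
    have hy' : y ≤ x := hy
    simp only
    rw [← mul_assoc, ← Real.exp_add, abs_of_nonneg (by linarith)]
    ring_nf
  have hright : Set.EqOn (fun y => Real.exp (-|x - y| / α) * h y)
      (fun y => Real.exp (x / α) * (Real.exp (-y / α) * h y)) (Set.Ioi x) := by
    intro y hy
    have hy' : x < y := hy
    simp only
    rw [← mul_assoc, ← Real.exp_add, abs_of_nonpos (by linarith)]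
    ring_nf
  have hl := (integrableOn_Iic_exp_div_mul hα hi x).const_mul (Real.exp (-x / α))
  have hr := (integrableOn_Ioi_exp_neg_div_mul hα hi x).const_mul (Real.exp (x / α))
  rw [← intervalIntegral.integral_Iic_add_Ioi
      (IntegrableOn.congr_fun hl hleft.symm measurableSet_Iic)
      (IntegrableOn.congr_fun hr hright.symm measurableSet_Ioi),
    setIntegral_congr_fun measurableSet_Iic hleft, setIntegral_congr_fun measurableSet_Ioi hright,
    integral_const_mul, integral_const_mul]

theorem stmt10 (α : ℝ) (hα : 0 < α)
    (h : SchwartzMap ℝ ℝ)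
    (K₁ : ℝ → ℝ)
    (hK₁ : ∀ x, K₁ x = (1 / (2 * α)) * Real.exp (-|x| / α))
    (u : ℝ → ℝ)
    (hu : ∀ x, u x = ∫ y : ℝ, K₁ (x - y) * h y) :
    (∀ x, DifferentiableAt ℝ u x) ∧ (∀ x, DifferentiableAt ℝ (deriv u) x) ∧
      ∀ x : ℝ, u x - α ^ 2 * deriv (deriv u) x = h x := by
  have hi : Integrable h := h.integrable
  have hα0 : α ≠ 0 := hα.ne'
  have hc : Continuous h := h.continuous
  set A : ℝ → ℝ := fun x => ∫ y in Set.Iic x, Real.exp (y / α) * h y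
  set B : ℝ → ℝ := fun x => ∫ y in Set.Ioi x, Real.exp (-y / α) * h y
  have dA (x : ℝ) : HasDerivAt A (Real.exp (x / α) * h x) x :=
    hasDerivAt_integral_Iic (by fun_prop) (integrableOn_Iic_exp_div_mul hα hi) x
  have dB (x : ℝ) : HasDerivAt B (-(Real.exp (-x / α) * h x)) x :=
    hasDerivAt_integral_Ioi (by fun_prop) (integrableOn_Ioi_exp_neg_div_mul hα hi) x
  have hu' : u = fun x =>
      (1 / (2 * α)) * (Real.exp (-x / α) * A x + Real.exp (x / α) * B x) := by
    funext x
    rw [hu, ← integral_exp_neg_abs_sub_div_mul hα hi x, ← integral_const_mul]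
    simp only [hK₁, mul_assoc]
  have dexp (x : ℝ) : HasDerivAt (fun x => Real.exp (x / α)) (Real.exp (x / α) * (1 / α)) x :=
    ((hasDerivAt_id x).div_const α).exp
  have dexp_neg (x : ℝ) :
      HasDerivAt (fun x => Real.exp (-x / α)) (Real.exp (-x / α) * (-1 / α)) x :=
    ((hasDerivAt_id x).neg.div_const α).exp
  have hexp (x : ℝ) : Real.exp (-(x / α)) * Real.exp (x / α) = 1 := by
    rw [← Real.exp_add, neg_add_cancel, Real.exp_zero]
  have du (x : ℝ) : HasDerivAt u
      ((1 / (2 * α ^ 2)) * (Real.exp (x / α) * B x - Real.exp (-x / α) * A x)) x := by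
    rw [hu']
    refine ((((dexp_neg x).mul (dA x)).add ((dexp x).mul (dB x))).const_mul
      (1 / (2 * α))).congr_deriv ?_
    field_simp
    ring
  have hderiv : deriv u = fun x =>
      (1 / (2 * α ^ 2)) * (Real.exp (x / α) * B x - Real.exp (-x / α) * A x) :=
    funext fun x => (du x).deriv
  have ddu (x : ℝ) : HasDerivAt (deriv u) ((u x - h x) / α ^ 2) x := by
    rw [hderiv, hu']
    refine ((((dexp x).mul (dB x)).sub ((dexp_neg x).mul (dA x))).const_mul
      (1 / (2 * α ^ 2))).congr_deriv ?_
    field_simp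
    linear_combination (-2 * α * h x) * hexp x
  refine ⟨fun x => (du x).differentiableAt, fun x => (ddu x).differentiableAt, fun x => ?_⟩
  rw [(ddu x).deriv]
  field_simp
  ring
end

section
/- Let α > 0, and set A = (1/α)·√(1/√2 − 1/2) and B = (1/α)·√(1/√2 + 1/2). Define K₃(x) = (1/2) e^{−B|x|} [ (A + B) sin(A|x|) − (A − B) cos(A x) ]. Then K₃ is not nonnegative: there exists x ∈ ℝ with K₃(x) < 0. -/
theorem stmt11 (α : ℝ) (hα : 0 < α)
    (A B : ℝ)
    (hA : A = (1 / α) * Real.sqrt (1 / Real.sqrt 2 - 1 / 2))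
    (hB : B = (1 / α) * Real.sqrt (1 / Real.sqrt 2 + 1 / 2))
    (K₃ : ℝ → ℝ)
    (hK₃ : ∀ x, K₃ x = (1 / 2) * Real.exp (-B * |x|) *
      ((A + B) * Real.sin (A * |x|) - (A - B) * Real.cos (A * x))) :
    ∃ x : ℝ, K₃ x < 0 := by
  have h_sqrt : Real.sqrt 2 < 2 := by
    rw [Real.sqrt_lt' (by norm_num)]; norm_num
  have h_inv : (1 : ℝ) / 2 < 1 / Real.sqrt 2 :=
    one_div_lt_one_div_of_lt (by positivity) h_sqrt
  have hA0 : 0 < A := by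
    rw [hA]
    exact mul_pos (by positivity) (Real.sqrt_pos.mpr (by linarith))
  have hB0 : 0 ≤ B := by rw [hB]; positivity
  have h_angle : A * ((Real.pi / 2 + Real.pi) / A) = Real.pi / 2 + Real.pi := by
    field_simp
  have h_abs : |(Real.pi / 2 + Real.pi) / A| = (Real.pi / 2 + Real.pi) / A :=
    abs_of_pos (by positivity)
  refine ⟨(Real.pi / 2 + Real.pi) / A, ?_⟩
  rw [hK₃, h_abs, h_angle, Real.sin_add_pi, Real.cos_add_pi, Real.sin_pi_div_two,
    Real.cos_pi_div_two]
  exact mul_neg_of_pos_of_neg (by positivity) (by linarith)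
end

section
/- Let α > 0. For every k ∈ ℝ, ∫_ℝ K₂(x) e^{−i k x} dx = 1 / (1 + α² k²)². -/
open MeasureTheory Complex

theorem integrableOn_ofReal_mul_cexp_neg_mul_Ioi {b : ℂ} (hb : 0 < b.re) :
    IntegrableOn (fun x : ℝ => (x : ℂ) * cexp (-b * x)) (Set.Ioi 0) := by
  have h := integrableOn_rpow_mul_exp_neg_mul_rpow (s := 1) (p := 1) (by norm_num) one_pos hb
  refine Integrable.mono' h (Continuous.aestronglyMeasurable (by fun_prop)) ?_
  refine (ae_restrict_iff' measurableSet_Ioi).mpr (ae_of_all _ fun x (hx : 0 < x) => ?_)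
  simp [Complex.norm_exp, abs_of_pos hx]

theorem tendsto_ofReal_mul_cexp_neg_mul_atTop {b : ℂ} (hb : 0 < b.re) :
    Filter.Tendsto (fun x : ℝ => (x : ℂ) * cexp (-b * x)) Filter.atTop (nhds 0) := by
  rw [tendsto_zero_iff_norm_tendsto_zero]
  refine (tendsto_rpow_mul_exp_neg_mul_atTop_nhds_zero 1 b.re hb).congr' ?_
  filter_upwards [Filter.eventually_gt_atTop 0] with x hx
  simp [Complex.norm_exp, abs_of_pos hx]

theorem tendsto_cexp_neg_mul_atTop {b : ℂ} (hb : 0 < b.re) :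
    Filter.Tendsto (fun x : ℝ => cexp (-b * x)) Filter.atTop (nhds 0) := by
  rw [tendsto_zero_iff_norm_tendsto_zero]
  refine (tendsto_rpow_mul_exp_neg_mul_atTop_nhds_zero 0 b.re hb).congr fun x => ?_
  simp [Complex.norm_exp]

theorem integral_ofReal_mul_cexp_neg_mul_Ioi {b : ℂ} (hb : 0 < b.re) :
    ∫ x : ℝ in Set.Ioi 0, (x : ℂ) * cexp (-b * x) = 1 / b ^ 2 := by
  have hb0 : b ≠ 0 := by rintro rfl; simp at hb
  have hderiv (x : ℝ) : HasDerivAt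
      (fun x : ℝ => -(1 / b) * ((x : ℂ) * cexp (-b * x)) - 1 / b ^ 2 * cexp (-b * x))
      ((x : ℂ) * cexp (-b * x)) x := by
    have hx : HasDerivAt (fun x : ℝ => (x : ℂ)) 1 x := ofRealCLM.hasDerivAt
    have hexp := (hx.const_mul (-b)).cexp
    refine (((hx.mul hexp).const_mul (-(1 / b))).sub (hexp.const_mul (1 / b ^ 2))).congr_deriv ?_
    field_simp
    ring
  have hlim := ((tendsto_ofReal_mul_cexp_neg_mul_atTop hb).const_mul (-(1 / b))).sub
    ((tendsto_cexp_neg_mul_atTop hb).const_mul (1 / b ^ 2))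
  rw [integral_Ioi_of_hasDerivAt_of_tendsto' (fun x _ => hderiv x)
    (integrableOn_ofReal_mul_cexp_neg_mul_Ioi hb) hlim]
  simp

theorem integrableOn_affine_mul_cexp_neg_mul_Ioi (c a : ℂ) {b : ℂ} (hb : 0 < b.re) :
    IntegrableOn (fun x : ℝ => c * (a * cexp (-b * x) + x * cexp (-b * x))) (Set.Ioi 0) :=
  (((integrableOn_exp_mul_complex_Ioi (by simpa using hb) 0).const_mul a).add
    (integrableOn_ofReal_mul_cexp_neg_mul_Ioi hb)).const_mul c

theorem integral_affine_mul_cexp_neg_mul_Ioi (c a : ℂ) {b : ℂ} (hb : 0 < b.re) :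
    ∫ x : ℝ in Set.Ioi 0, c * (a * cexp (-b * x) + x * cexp (-b * x)) =
      c * (a / b + 1 / b ^ 2) := by
  have hb' : (-b).re < 0 := by simpa using hb
  rw [integral_const_mul, integral_add
    ((integrableOn_exp_mul_complex_Ioi hb' 0).const_mul a)
    (integrableOn_ofReal_mul_cexp_neg_mul_Ioi hb), integral_const_mul,
    integral_exp_mul_complex_Ioi hb', integral_ofReal_mul_cexp_neg_mul_Ioi hb]
  simp [div_eq_mul_inv]

theorem integral_eq_integral_Ioi_comp_neg_add {f : ℝ → ℂ}
    (hneg : IntegrableOn (fun x => f (-x)) (Set.Ioi 0)) (hpos : IntegrableOn f (Set.Ioi 0)) :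
    ∫ x, f x = (∫ x in Set.Ioi 0, f (-x)) + ∫ x in Set.Ioi 0, f x := by
  have hIic : IntegrableOn f (Set.Iic 0) := by
    rw [integrableOn_Iic_iff_integrableOn_Iio]
    rw [← neg_zero] at hneg
    simpa using hneg.comp_neg_Iio
  rw [← intervalIntegral.integral_Iic_add_Ioi hIic hpos, integral_comp_neg_Ioi, neg_zero]

theorem stmt14 (α : ℝ) (hα : 0 < α)
    (K₂ : ℝ → ℝ)
    (hK₂ : ∀ x, K₂ x = (1 / (4 * α ^ 2)) * (α + |x|) * Real.exp (-|x| / α)) :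
    ∀ k : ℝ, (∫ x : ℝ, (K₂ x : ℂ) * Complex.exp (-Complex.I * k * x)) =
      1 / (1 + (α : ℂ) ^ 2 * (k : ℂ) ^ 2) ^ 2 := by
  intro k
  have hα0 : (α : ℂ) ≠ 0 := ofReal_ne_zero.mpr hα.ne'
  have hre (s : ℝ) : 0 < (1 / (α : ℂ) + I * s).re := by
    rw [← ofReal_one, ← ofReal_div]
    simpa using hα
  have hK (x s : ℝ) (hx : 0 < x) : (K₂ x : ℂ) * cexp (-I * s * x) =
      1 / (4 * α ^ 2) * (α * cexp (-(1 / (α : ℂ) + I * s) * x)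
        + x * cexp (-(1 / (α : ℂ) + I * s) * x)) := by
    have hexp : cexp (-(1 / (α : ℂ) + I * s) * x) = cexp (-x / α) * cexp (-I * s * x) := by
      rw [← Complex.exp_add]
      ring_nf
    rw [hexp, hK₂, abs_of_pos hx]
    push_cast
    ring
  have hKneg (x : ℝ) (hx : 0 < x) : (K₂ (-x) : ℂ) * cexp (-I * k * (-x : ℝ)) =
      1 / (4 * α ^ 2) * (α * cexp (-(1 / (α : ℂ) + I * (-k : ℝ)) * x)
        + x * cexp (-(1 / (α : ℂ) + I * (-k : ℝ)) * x)) := by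
    rw [← hK x (-k) hx, hK₂, hK₂, abs_neg]
    push_cast
    ring_nf
  have hint (s : ℝ) := integrableOn_affine_mul_cexp_neg_mul_Ioi (1 / (4 * α ^ 2)) α (hre s)
  rw [integral_eq_integral_Ioi_comp_neg_add
      (f := fun x : ℝ => (K₂ x : ℂ) * cexp (-I * k * x))
      ((hint (-k)).congr_fun (fun x hx => (hKneg x hx).symm) measurableSet_Ioi)
      ((hint k).congr_fun (fun x hx => (hK x k hx).symm) measurableSet_Ioi),
    setIntegral_congr_fun measurableSet_Ioi hKneg,
    setIntegral_congr_fun measurableSet_Ioi (fun x hx => hK x k hx),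
    integral_affine_mul_cexp_neg_mul_Ioi _ _ (hre _),
    integral_affine_mul_cexp_neg_mul_Ioi _ _ (hre _)]
  have hfactor (s : ℝ) : 1 / (α : ℂ) + I * s = (1 + I * (α * s)) / α := by
    field_simp
  have hne (s : ℝ) : 1 + I * ((α : ℂ) * s) ≠ 0 := fun h => by
    simpa using congrArg re h
  have hprod : 1 + (α : ℂ) ^ 2 * (k : ℂ) ^ 2 =
      (1 + I * (α * k)) * (1 + I * (α * (-k : ℝ))) := by
    push_cast
    linear_combination (α : ℂ) ^ 2 * k ^ 2 * I_sq
  have h₁ := hne k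
  have h₂ := hne (-k)
  rw [hprod, hfactor, hfactor]
  have hsum : (1 + I * ((α : ℂ) * (-k : ℝ))) = 2 - (1 + I * (α * k)) := by
    push_cast
    ring
  rw [hsum] at h₂ ⊢
  generalize 1 + I * ((α : ℂ) * k) = u at *
  field_simp
  ring
end

section
/- Let α > 0, N a positive integer, w₁, …, w_N ∈ ℝ, and x₁ < x₂ < ⋯ < x_N real numbers. For each i define aᵢ = Σ_{j=1}^{i−1} w_j e^{x_j/α}, bᵢ = Σ_{j=1}^{i−1} w_j x_j e^{x_j/α}, cᵢ = Σ_{j=i+1}^{N} w_j e^{−x_j/α}, dᵢ = Σ_{j=i+1}^{N} w_j x_j e^{−x_j/α}. Then for every i, Σ_{j=1}^{N} w_j K₂(xᵢ − x_j) = (1/(4α²)) [ e^{−xᵢ/α} ( (α + xᵢ) aᵢ − bᵢ ) + e^{xᵢ/α} ( (α − xᵢ) cᵢ + dᵢ ) ] + wᵢ K₂(0). -/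
open Finset

theorem stmt15 (α : ℝ) (hα : 0 < α) (N : ℕ) (hN : 0 < N)
    (w x : Fin N → ℝ) (hx : StrictMono x)
    (K₂ : ℝ → ℝ)
    (hK₂ : ∀ y, K₂ y = (1 / (4 * α ^ 2)) * (α + |y|) * Real.exp (-|y| / α))
    (a b c d : Fin N → ℝ)
    (ha : ∀ i, a i = ∑ j ∈ Finset.univ.filter (fun j => j < i), w j * Real.exp (x j / α))
    (hb : ∀ i, b i = ∑ j ∈ Finset.univ.filter (fun j => j < i), w j * x j * Real.exp (x j / α))
    (hc : ∀ i, c i = ∑ j ∈ Finset.univ.filter (fun j => i < j), w j * Real.exp (-(x j) / α))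
    (hd : ∀ i, d i = ∑ j ∈ Finset.univ.filter (fun j => i < j), w j * x j * Real.exp (-(x j) / α)) :
    ∀ i : Fin N,
      ∑ j, w j * K₂ (x i - x j) =
        (1 / (4 * α ^ 2)) *
          (Real.exp (-(x i) / α) * ((α + x i) * a i - b i) +
            Real.exp (x i / α) * ((α - x i) * c i + d i)) + w i * K₂ 0 := by
  intro i
  have hself : w i * K₂ 0 = ∑ j, if j = i then w j * K₂ 0 else 0 := by simp
  rw [hself, ha, hb, hc, hd]
  simp only [Finset.sum_filter, Finset.mul_sum, ← Finset.sum_sub_distrib,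
    ← Finset.sum_add_distrib]
  refine Finset.sum_congr rfl fun j _ => ?_
  rcases lt_trichotomy j i with h | rfl | h
  · have hexp : Real.exp (-(x i - x j) / α) = Real.exp (-(x i) / α) * Real.exp (x j / α) := by
      rw [← Real.exp_add]
      congr 1
      ring
    rw [hK₂, abs_of_pos (sub_pos.mpr (hx h)), hexp]
    simp only [h, h.ne, h.not_gt, if_true, if_false]
    ring
  · simp
  · have hexp : Real.exp (-(-(x i - x j)) / α) = Real.exp (x i / α) * Real.exp (-(x j) / α) := by
      rw [← Real.exp_add]
      congr 1
      ring
    rw [hK₂, abs_of_neg (sub_neg.mpr (hx h)), hexp]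
    simp only [h, h.ne', h.not_gt, if_true, if_false]
    ring
end
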